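/- There is no irreducible polynomial f : ℝ³ → ℝ of degree three satisfying the cmc equation 4·(2H)²·|∇f|⁶ − (2|∇f|²Δf − ∇fᵗ∇|∇f|²)² = p·f with H ≠ 0 and p a polynomial, assuming f depends on three variables. More generally (main theorem): if f : ℝⁿ → ℝ is an irreducible polynomial of degree three, then there do not exist H ≠ 0 and a polynomial p with 4(n−1)²H²|∇f|⁶ − (2|∇f|²Δf − ∇fᵗ∇|∇f|²)² = p·f. -/

import Mathlib

open MvPolynomial

/-- Squared norm of the gradient of a polynomial. -/
noncomputable def gradSq {n : ℕ} (f : MvPolynomial (Fin n) ℝ) : MvPolynomial (Fin n) ℝ :=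
  ∑ i, (pderiv i f) ^ 2

/-- Laplacian of a polynomial. -/
noncomputable def lap {n : ℕ} (f : MvPolynomial (Fin n) ℝ) : MvPolynomial (Fin n) ℝ :=
  ∑ i, pderiv i (pderiv i f)

/-- Δ₁ f = 2|∇f|²Δf − ∇fᵗ∇|∇f|². -/
noncomputable def delta1 {n : ℕ} (f : MvPolynomial (Fin n) ℝ) : MvPolynomial (Fin n) ℝ :=
  2 * gradSq f * lap f - ∑ i, pderiv i f * pderiv i (gradSq f)

lemma hom0 {n : ℕ} (p : MvPolynomial (Fin n) ℝ) (hp : p.IsHomogeneous 0) (x y : Fin n → ℝ) :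
    eval x p = eval y p := by
  have h : p.totalDegree = 0 := Nat.le_zero.mp hp.totalDegree_le
  rw [totalDegree_eq_zero_iff_eq_C] at h
  rw [h]; simp

lemma euler_eval {n : ℕ} (p : MvPolynomial (Fin n) ℝ) (k : ℕ) (hp : p.IsHomogeneous k)
    (x : Fin n → ℝ) : (k : ℝ) * eval x p = ∑ i, x i * eval x (pderiv i p) := by
  have h := congrArg (eval x) hp.sum_X_mul_pderiv
  simpa using h.symm

lemma rep1 {n : ℕ} (p : MvPolynomial (Fin n) ℝ) (hp : p.IsHomogeneous 1) (u v : Fin n → ℝ) :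
    ∃ c0 c1 : ℝ, ∀ s t : ℝ, eval (s • u + t • v) p = c0 * s + c1 * t := by
  refine ⟨∑ i, u i * eval 0 (pderiv i p), ∑ i, v i * eval 0 (pderiv i p), fun s t => ?_⟩
  have h := euler_eval p 1 hp (s • u + t • v)
  simp only [Nat.cast_one, one_mul] at h
  rw [h, Finset.sum_mul, Finset.sum_mul, ← Finset.sum_add_distrib]
  refine Finset.sum_congr rfl fun i _ => ?_
  rw [hom0 _ hp.pderiv (s • u + t • v) 0]
  simp only [Pi.add_apply, Pi.smul_apply, smul_eq_mul]
  ring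

lemma rep2 {n : ℕ} (p : MvPolynomial (Fin n) ℝ) (hp : p.IsHomogeneous 2) (u v : Fin n → ℝ) :
    ∃ c0 c1 c2 : ℝ, ∀ s t : ℝ,
      eval (s • u + t • v) p = c0 * s ^ 2 + c1 * s * t + c2 * t ^ 2 := by
  have hd : ∀ i, (pderiv i p).IsHomogeneous 1 := fun i => hp.pderiv
  choose a b hab using fun i => rep1 (pderiv i p) (hd i) u v
  refine ⟨∑ i, u i * a i / 2, ∑ i, (u i * b i + v i * a i) / 2, ∑ i, v i * b i / 2,
    fun s t => ?_⟩
  have h := euler_eval p 2 hp (s • u + t • v)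
  have h2 : eval (s • u + t • v) p =
      ∑ i, (s • u + t • v) i * eval (s • u + t • v) (pderiv i p) / 2 := by
    rw [← Finset.sum_div, ← h]; push_cast; ring
  rw [h2]
  simp only [Finset.sum_mul]
  rw [← Finset.sum_add_distrib, ← Finset.sum_add_distrib]
  refine Finset.sum_congr rfl fun i _ => ?_
  rw [hab]
  simp only [Pi.add_apply, Pi.smul_apply, smul_eq_mul]
  ring

lemma rep3 {n : ℕ} (p : MvPolynomial (Fin n) ℝ) (hp : p.IsHomogeneous 3) (u v : Fin n → ℝ) :
    ∃ c0 c1 c2 c3 : ℝ, ∀ s t : ℝ,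
      eval (s • u + t • v) p = c0 * s ^ 3 + c1 * s ^ 2 * t + c2 * s * t ^ 2 + c3 * t ^ 3 := by
  have hd : ∀ i, (pderiv i p).IsHomogeneous 2 := fun i => hp.pderiv
  choose a b c hab using fun i => rep2 (pderiv i p) (hd i) u v
  refine ⟨∑ i, u i * a i / 3, ∑ i, (u i * b i + v i * a i) / 3,
    ∑ i, (u i * c i + v i * b i) / 3, ∑ i, v i * c i / 3, fun s t => ?_⟩
  have h := euler_eval p 3 hp (s • u + t • v)
  have h2 : eval (s • u + t • v) p =
      ∑ i, (s • u + t • v) i * eval (s • u + t • v) (pderiv i p) / 3 := by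
    rw [← Finset.sum_div, ← h]; push_cast; ring
  rw [h2]
  simp only [Finset.sum_mul]
  rw [← Finset.sum_add_distrib, ← Finset.sum_add_distrib, ← Finset.sum_add_distrib]
  refine Finset.sum_congr rfl fun i _ => ?_
  rw [hab]
  simp only [Pi.add_apply, Pi.smul_apply, smul_eq_mul]
  ring

lemma hasDeriv_line {n : ℕ} (p : MvPolynomial (Fin n) ℝ) (x v : Fin n → ℝ) (t : ℝ) :
    HasDerivAt (fun t : ℝ => eval (x + t • v) p)
      (∑ i, v i * eval (x + t • v) (pderiv i p)) t := by
  induction p using MvPolynomial.induction_on with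
  | C a => simpa using hasDerivAt_const t a
  | add p q hp hq =>
    simp only [map_add, mul_add, Finset.sum_add_distrib]
    exact hp.add hq
  | mul_X p j hp =>
    have hx : HasDerivAt (fun t : ℝ => eval (x + t • v) (X j : MvPolynomial (Fin n) ℝ)) (v j) t := by
      simpa using ((hasDerivAt_id t).mul_const (v j)).const_add (x j)
    have h := hp.mul hx
    have hfun : (fun t : ℝ => eval (x + t • v) (p * X j)) = (fun t : ℝ => eval (x + t • v) p) *
        (fun t : ℝ => eval (x + t • v) (X j : MvPolynomial (Fin n) ℝ)) := by
      funext t; simp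
    rw [hfun]
    refine h.congr_deriv (Eq.symm ?_)
    simp only [Derivation.leibniz, smul_eq_mul, map_add, map_mul, pderiv_X, mul_add,
      Finset.sum_add_distrib, eval_X]
    rw [add_comm]
    congr 1
    · rw [Finset.sum_mul]
      exact Finset.sum_congr rfl fun i _ => by ring
    · rw [Finset.sum_eq_single j]
      · simp; ring
      · intro i _ hij
        simp [hij.symm]
      · simp

/-- the decomposition of a cubic into homogeneous pieces -/
lemma decomp {n : ℕ} (f : MvPolynomial (Fin n) ℝ) (hdeg : f.totalDegree = 3) :
    f = homogeneousComponent 0 f + homogeneousComponent 1 f + homogeneousComponent 2 f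
      + homogeneousComponent 3 f := by
  conv_lhs => rw [← sum_homogeneousComponent f, hdeg]
  simp [Finset.sum_range_succ]

lemma exists_dir {n : ℕ} (f : MvPolynomial (Fin n) ℝ) (hdeg : f.totalDegree = 3) :
    ∃ v : Fin n → ℝ, eval v (homogeneousComponent 3 f) ≠ 0 := by
  by_contra! h
  have h0 : homogeneousComponent 3 f = 0 := MvPolynomial.funext fun x => by simp [h x]
  have hd := decomp f hdeg
  rw [h0, add_zero] at hd
  have h1 : f.totalDegree ≤ 2 := by
    rw [hd]
    refine (totalDegree_add _ _).trans (max_le ((totalDegree_add _ _).trans (max_le ?_ ?_)) ?_)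
    · exact (homogeneousComponent_isHomogeneous 0 f).totalDegree_le.trans (by norm_num)
    · exact (homogeneousComponent_isHomogeneous 1 f).totalDegree_le.trans (by norm_num)
    · exact (homogeneousComponent_isHomogeneous 2 f).totalDegree_le
  omega

lemma cubic_root (k a b c : ℝ) (hk : k ≠ 0) : ∃ t : ℝ, k * t ^ 3 + a * t ^ 2 + b * t + c = 0 := by
  have key : ∀ a b c : ℝ, ∃ t : ℝ, t ^ 3 + a * t ^ 2 + b * t + c = 0 := by
    intro a b c
    set R := 1 + |a| + |b| + |c| with hR
    have ha := abs_nonneg a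
    have hb := abs_nonneg b
    have hc := abs_nonneg c
    have hR1 : 1 ≤ R := by linarith
    have hcont : Continuous fun t : ℝ => t ^ 3 + a * t ^ 2 + b * t + c := by fun_prop
    have e1 : R ^ 3 = R ^ 2 + |a| * R ^ 2 + |b| * R ^ 2 + |c| * R ^ 2 := by
      rw [pow_succ R 2]; nth_rewrite 2 [hR]; ring
    have a1 : -(|a| * R ^ 2) ≤ a * R ^ 2 ∧ a * R ^ 2 ≤ |a| * R ^ 2 := by
      constructor <;> nlinarith [neg_abs_le a, le_abs_self a, sq_nonneg R]
    have b1 : -(|b| * R ^ 2) ≤ b * R ∧ b * R ≤ |b| * R ^ 2 := by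
      have : |b| * R ≤ |b| * R ^ 2 := by gcongr; nlinarith
      constructor <;> nlinarith [neg_abs_le b, le_abs_self b]
    have c1 : -(|c| * R ^ 2) ≤ c ∧ c ≤ |c| * R ^ 2 := by
      have : |c| * 1 ≤ |c| * R ^ 2 := by gcongr; nlinarith
      constructor <;> nlinarith [neg_abs_le c, le_abs_self c]
    have hpos : 0 ≤ R ^ 3 + a * R ^ 2 + b * R + c := by nlinarith [sq_nonneg R]
    have hneg : (-R) ^ 3 + a * (-R) ^ 2 + b * (-R) + c ≤ 0 := by nlinarith [sq_nonneg R]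
    obtain ⟨t, -, ht⟩ := intermediate_value_Icc (by linarith : -R ≤ R) hcont.continuousOn
      (Set.mem_Icc.mpr ⟨hneg, hpos⟩)
    exact ⟨t, ht⟩
  obtain ⟨t, ht⟩ := key (a / k) (b / k) (c / k)
  refine ⟨t, ?_⟩
  have : k * t ^ 3 + a * t ^ 2 + b * t + c
      = k * (t ^ 3 + a / k * t ^ 2 + b / k * t + c / k) := by field_simp
  rw [this, ht, mul_zero]

/-- A cubic that is a function of one affine coordinate is reducible. -/
lemma final_red {n : ℕ} (f a : MvPolynomial (Fin n) ℝ) (hirr : Irreducible f) (v : Fin n → ℝ)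
    (k c2 c1 c0 : ℝ) (hk : k ≠ 0) (hav : ∀ t : ℝ, eval (t • v) a = t)
    (hf : ∀ x, eval x f = k * eval x a ^ 3 + c2 * eval x a ^ 2 + c1 * eval x a + c0) : False := by
  obtain ⟨r, hr⟩ := cubic_root k c2 c1 c0 hk
  have hfac : f = (a - C r) * (C k * a ^ 2 + C (c2 + k * r) * a + C (c1 + c2 * r + k * r ^ 2)) := by
    refine MvPolynomial.funext fun x => ?_
    rw [hf x]
    simp only [map_mul, map_sub, map_add, map_pow, eval_C]
    linear_combination hr
  rcases hirr.isUnit_or_isUnit hfac with h | h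
  · have h1 := h.map (eval (r • v))
    simp [hav] at h1
  · rw [isUnit_iff_eq_C_of_isReduced] at h
    obtain ⟨q, -, hq⟩ := h
    have e : ∀ t : ℝ, k * t ^ 2 + (c2 + k * r) * t + (c1 + c2 * r + k * r ^ 2) = q := by
      intro t
      have := congrArg (eval (t • v)) hq
      simpa only [map_mul, map_sub, map_add, map_pow, eval_C, hav] using this
    have e0 := e 0
    have e1 := e 1
    have e2 := e (-1)
    apply hk
    linarith

set_option maxHeartbeats 1000000 in
lemma real_stage1 (C d e q0 q1 q2 l0 l1 k : ℝ) (hC : 0 ≤ C)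
    (h : ∀ s t : ℝ, d * s ^ 2 * t + e * s * t ^ 2 + t ^ 3 + (q0 * s ^ 2 + q1 * s * t + q2 * t ^ 2)
        + (l0 * s + l1 * t) + k = 0 →
      |d * s ^ 2 + 2 * e * s * t + 3 * t ^ 2 + q1 * s + 2 * q2 * t + l1|
        ≤ C * (1 + |s| + |t|)) : d = 0 := by
  by_contra hd
  have hdprm : 0 < |d| := abs_pos.mpr hd
  obtain ⟨T, hT⟩ : ∃ T, d * T = |q0| + 1 := ⟨(|q0| + 1) / d, by field_simp⟩
  obtain ⟨m1, hm1⟩ : ∃ z : ℝ, z = |e * T ^ 2 + q1 * T + l0| := ⟨_, rfl⟩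
  obtain ⟨m2, hm2⟩ : ∃ z : ℝ, z = |T ^ 3 + q2 * T ^ 2 + l1 * T + k| := ⟨_, rfl⟩
  obtain ⟨m3, hm3⟩ : ∃ z : ℝ, z = |e * T ^ 2 - q1 * T + l0| := ⟨_, rfl⟩
  obtain ⟨m4, hm4⟩ : ∃ z : ℝ, z = |-T ^ 3 + q2 * T ^ 2 - l1 * T + k| := ⟨_, rfl⟩
  obtain ⟨P, hP⟩ : ∃ z : ℝ, z = C * (2 + |T|) + 2 * |e| * |T| + 3 * |T| ^ 2 + |q1| + 2 * |q2| * |T| + |l1| := ⟨_, rfl⟩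
  have hP0 : 0 ≤ P := by rw [hP]; positivity
  obtain ⟨s, hs⟩ : ∃ z : ℝ, z = 1 + m1 + m2 + m3 + m4 + (P + 1) / |d| := ⟨_, rfl⟩
  have n1 : 0 ≤ m1 := hm1 ▸ abs_nonneg _
  have n2 : 0 ≤ m2 := hm2 ▸ abs_nonneg _
  have n3 : 0 ≤ m3 := hm3 ▸ abs_nonneg _
  have n4 : 0 ≤ m4 := hm4 ▸ abs_nonneg _
  have n5 : 0 ≤ (P + 1) / |d| := by positivity
  have hs1 : 1 ≤ s := by linarith
  have hsd : P + 1 ≤ |d| * s := by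
    have : |d| * ((P + 1) / |d|) = P + 1 := by field_simp
    have h2 : |d| * ((P + 1) / |d|) ≤ |d| * s := by
      apply mul_le_mul_of_nonneg_left _ hdprm.le
      linarith
    linarith
  have hq := neg_abs_le q0
  have hqprm := le_abs_self q0
  have hpos : 0 ≤ d * s ^ 2 * T + e * s * T ^ 2 + T ^ 3 + (q0 * s ^ 2 + q1 * s * T + q2 * T ^ 2)
        + (l0 * s + l1 * T) + k := by
    have e1 : d * s ^ 2 * T + e * s * T ^ 2 + T ^ 3 + (q0 * s ^ 2 + q1 * s * T + q2 * T ^ 2)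
        + (l0 * s + l1 * T) + k = (d * T + q0) * s ^ 2 + (e * T ^ 2 + q1 * T + l0) * s
          + (T ^ 3 + q2 * T ^ 2 + l1 * T + k) := by ring
    rw [e1, hT]
    have a1 : -m1 * s ≤ (e * T ^ 2 + q1 * T + l0) * s :=
      mul_le_mul_of_nonneg_right (hm1 ▸ neg_abs_le _) (by linarith)
    have a2 := neg_abs_le (T ^ 3 + q2 * T ^ 2 + l1 * T + k)
    have a3 : 1 * s ^ 2 ≤ (|q0| + 1 + q0) * s ^ 2 :=
      mul_le_mul_of_nonneg_right (by linarith) (sq_nonneg s)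
    have a4 : (m1 + m2) * s ≤ s * s := mul_le_mul_of_nonneg_right (by linarith) (by linarith)
    have a5 : m2 * 1 ≤ m2 * s := mul_le_mul_of_nonneg_left hs1 n2
    rw [← hm2] at a2
    linarith
  have hneg : d * s ^ 2 * (-T) + e * s * (-T) ^ 2 + (-T) ^ 3
        + (q0 * s ^ 2 + q1 * s * (-T) + q2 * (-T) ^ 2)
        + (l0 * s + l1 * (-T)) + k ≤ 0 := by
    have e1 : d * s ^ 2 * (-T) + e * s * (-T) ^ 2 + (-T) ^ 3
        + (q0 * s ^ 2 + q1 * s * (-T) + q2 * (-T) ^ 2)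
        + (l0 * s + l1 * (-T)) + k = (-(d * T) + q0) * s ^ 2 + (e * T ^ 2 - q1 * T + l0) * s
          + (-T ^ 3 + q2 * T ^ 2 - l1 * T + k) := by ring
    rw [e1, hT]
    have a1 : (e * T ^ 2 - q1 * T + l0) * s ≤ m3 * s :=
      mul_le_mul_of_nonneg_right (hm3 ▸ le_abs_self _) (by linarith)
    have a2 := le_abs_self (-T ^ 3 + q2 * T ^ 2 - l1 * T + k)
    have a3 : (-(|q0| + 1) + q0) * s ^ 2 ≤ (-1) * s ^ 2 :=
      mul_le_mul_of_nonneg_right (by linarith) (sq_nonneg s)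
    have a4 : (m3 + m4) * s ≤ s * s := mul_le_mul_of_nonneg_right (by linarith) (by linarith)
    have a5 : m4 * 1 ≤ m4 * s := mul_le_mul_of_nonneg_left hs1 n4
    rw [← hm4] at a2
    linarith
  have hcont : Continuous fun t : ℝ => d * s ^ 2 * t + e * s * t ^ 2 + t ^ 3
      + (q0 * s ^ 2 + q1 * s * t + q2 * t ^ 2) + (l0 * s + l1 * t) + k := by fun_prop
  obtain ⟨t, htm, ht⟩ := intermediate_value_uIcc (a := -T) (b := T) hcont.continuousOn
    (Set.mem_uIcc.mpr (Or.inl ⟨hneg, hpos⟩))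
  have htT : |t| ≤ |T| := by
    rcases Set.mem_uIcc.mp htm with ⟨h1, h2⟩ | ⟨h1, h2⟩
    · exact abs_le.mpr ⟨by linarith [le_abs_self T], by linarith [le_abs_self T]⟩
    · exact abs_le.mpr ⟨by linarith [neg_abs_le T], by linarith [neg_abs_le T]⟩
  have hb := h s t ht
  have hsabs : |s| = s := abs_of_nonneg (by linarith)
  rw [hsabs] at hb
  have key : |d| * s ^ 2 ≤ P * s := by
    have e1 : d * s ^ 2 = (d * s ^ 2 + 2 * e * s * t + 3 * t ^ 2 + q1 * s + 2 * q2 * t + l1)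
        - 2 * e * s * t - 3 * t ^ 2 - q1 * s - 2 * q2 * t - l1 := by ring
    have e2 : |d| * s ^ 2 = |d * s ^ 2| := by rw [abs_mul, abs_of_nonneg (sq_nonneg s)]
    have b1 : |2 * e * s * t| ≤ 2 * |e| * |T| * s := by
      rw [abs_mul, abs_mul, abs_mul, hsabs, abs_of_pos (by norm_num : (0:ℝ) < 2)]
      have : 2 * |e| * s * |t| ≤ 2 * |e| * s * |T| := by gcongr
      linarith
    have b2 : |3 * t ^ 2| ≤ 3 * |T| ^ 2 * s := by
      rw [abs_mul, abs_pow, abs_of_pos (by norm_num : (0:ℝ) < 3)]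
      have h1 : 3 * |t| ^ 2 ≤ 3 * |T| ^ 2 := by gcongr
      have h2 : 3 * |T| ^ 2 * 1 ≤ 3 * |T| ^ 2 * s := by gcongr
      linarith
    have b3 : |q1 * s| ≤ |q1| * s := by rw [abs_mul, hsabs]
    have b4 : |2 * q2 * t| ≤ 2 * |q2| * |T| * s := by
      rw [abs_mul, abs_mul, abs_of_pos (by norm_num : (0:ℝ) < 2)]
      have h1 : 2 * |q2| * |t| ≤ 2 * |q2| * |T| := by gcongr
      have h2 : 2 * |q2| * |T| * 1 ≤ 2 * |q2| * |T| * s := by gcongr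
      linarith
    have b5 : |l1| ≤ |l1| * s := le_mul_of_one_le_right (abs_nonneg _) hs1
    have b6 : C * (1 + s + |t|) ≤ C * (2 + |T|) * s := by
      have h1 : C * (1 + s + |t|) ≤ C * ((2 + |T|) * s) := by
        apply mul_le_mul_of_nonneg_left _ hC
        nlinarith [abs_nonneg T]
      linarith
    rw [e2, e1]
    calc _ ≤ |d * s ^ 2 + 2 * e * s * t + 3 * t ^ 2 + q1 * s + 2 * q2 * t + l1|
        + |2 * e * s * t| + |3 * t ^ 2| + |q1 * s| + |2 * q2 * t| + |l1| := by
          refine (abs_sub _ _).trans ?_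
          gcongr
          refine (abs_sub _ _).trans ?_
          gcongr
          refine (abs_sub _ _).trans ?_
          gcongr
          refine (abs_sub _ _).trans ?_
          gcongr
          exact abs_sub _ _
      _ ≤ P * s := by rw [hP]; linarith
  have : (P + 1) * s ≤ |d| * s * s := mul_le_mul_of_nonneg_right hsd (by linarith)
  linarith

lemma real_stage2 (C q0 q1 q2 l0 l1 k : ℝ) (hC : 0 ≤ C)
    (h : ∀ s t : ℝ, t ^ 3 + (q0 * s ^ 2 + q1 * s * t + q2 * t ^ 2) + (l0 * s + l1 * t) + k = 0 →
      |3 * t ^ 2 + q1 * s + 2 * q2 * t + l1| ≤ C * (1 + |t|)) :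
    q1 = 0 ∧ q0 = 0 ∧ l0 = 0 := by
  have hroot : ∀ s : ℝ, ∃ t : ℝ,
      t ^ 3 + (q0 * s ^ 2 + q1 * s * t + q2 * t ^ 2) + (l0 * s + l1 * t) + k = 0 := by
    intro s
    obtain ⟨t, ht⟩ := cubic_root 1 q2 (q1 * s + l1) (q0 * s ^ 2 + l0 * s + k) one_ne_zero
    exact ⟨t, by linear_combination ht⟩
  have hq2t : ∀ t : ℝ, |q2 * t| ≤ |q2| * |t| := fun t => (abs_mul _ _).le
  have hq1 : q1 = 0 := by
    by_contra hne
    obtain ⟨R, hR⟩ : ∃ z : ℝ, z = (C + 2 * |q2|) ^ 2 + C + |l1| + 1 := ⟨_, rfl⟩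
    obtain ⟨t, ht⟩ := hroot (R / q1)
    have hb := (abs_le.mp (h _ t ht)).2
    have e1 : q1 * (R / q1) = R := by field_simp
    rw [e1] at hb
    have h1 := (abs_le.mp (hq2t t)).1
    have h2 := neg_abs_le l1
    have h3 : t ^ 2 = |t| ^ 2 := (sq_abs t).symm
    rw [h3] at hb
    nlinarith [sq_nonneg (|t| - (C + 2 * |q2|)), sq_nonneg (|t| + (C + 2 * |q2|)), sq_nonneg (|t|)]
  subst hq1
  obtain ⟨P, hP⟩ : ∃ z : ℝ, z = C + 2 * |q2| + |l1| := ⟨_, rfl⟩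
  have hP0 : 0 ≤ P := by rw [hP]; positivity
  obtain ⟨Q, hQ⟩ : ∃ z : ℝ, z = (P + 1) ^ 3 + |q2| * (P + 1) ^ 2 + |l1| * (P + 1) + |k| := ⟨_, rfl⟩
  have hQ0 : 0 ≤ Q := by rw [hQ]; positivity
  have hbd : ∀ s : ℝ, |q0 * s ^ 2 + l0 * s| ≤ Q := by
    intro s
    obtain ⟨t, ht⟩ := hroot s
    have hb := (abs_le.mp (h _ t ht)).2
    have htP : |t| ≤ P + 1 := by
      by_contra! hlt
      have h1 := (abs_le.mp (hq2t t)).1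
      have h2 := neg_abs_le l1
      have h3 : t ^ 2 = |t| ^ 2 := (sq_abs t).symm
      rw [h3] at hb
      have h4 : 3 * |t| ^ 2 ≤ P * (1 + |t|) := by
        have : 0 ≤ |l1| * |t| := by positivity
        have : 0 ≤ |q2| := by positivity
        rw [hP]; nlinarith
      nlinarith
    have e1 : q0 * s ^ 2 + l0 * s = -(t ^ 3 + q2 * t ^ 2 + l1 * t + k) := by
      linear_combination ht
    rw [e1, abs_neg]
    calc |t ^ 3 + q2 * t ^ 2 + l1 * t + k| ≤ |t ^ 3| + |q2 * t ^ 2| + |l1 * t| + |k| := by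
          refine (abs_add_le _ _).trans ?_
          gcongr
          refine (abs_add_le _ _).trans ?_
          gcongr
          exact abs_add_le _ _
      _ = |t| ^ 3 + |q2| * |t| ^ 2 + |l1| * |t| + |k| := by simp only [abs_mul, abs_pow]
      _ ≤ Q := by rw [hQ]; gcongr
  have hq0 : q0 = 0 := by
    by_contra hne
    have hp : 0 < |q0| := abs_pos.mpr hne
    obtain ⟨s, hs⟩ : ∃ z : ℝ, z = 1 + Q / |q0| := ⟨_, rfl⟩
    have hs1 : 1 ≤ s := by have : 0 ≤ Q / |q0| := by positivity
                           linarith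
    have hqs : |q0| * s = |q0| + Q := by rw [hs]; field_simp
    have h1 := hbd s
    have h2 := hbd (-s)
    have h3 : |q0| * s ^ 2 ≤ Q := by
      rw [show |q0| * s ^ 2 = |q0 * s ^ 2| by rw [abs_mul, abs_of_nonneg (sq_nonneg s)]]
      rw [abs_le] at *
      constructor <;> nlinarith
    nlinarith
  subst hq0
  refine ⟨rfl, rfl, ?_⟩
  by_contra hne
  have h1 := (abs_le.mp (hbd ((Q + 1) / l0))).2
  have e1 : l0 * ((Q + 1) / l0) = Q + 1 := by field_simp
  rw [e1] at h1
  linarith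


lemma real_grad {n : ℕ} (g v : Fin n → ℝ) (h : Fin n → Fin n → ℝ) (K G D B N V : ℝ) (hK : 0 < K)
    (hB : 0 ≤ B) (hN : N = 2 * (n + n ^ 2)) (hV : V = ∑ i, v i ^ 2) (hG : G = ∑ i, g i ^ 2)
    (heq : K * G ^ 3 = D ^ 2)
    (hDe : D = 2 * G * (∑ i, h i i) - ∑ i, ∑ j, 2 * (g i * g j * h i j))
    (hh : ∀ i j, |h i j| ≤ B) :
    |∑ i, v i * g i| ≤ √(V * (N ^ 2 / K)) * B := by
  have hN0 : 0 ≤ N := by rw [hN]; positivity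
  have hV0 : 0 ≤ V := by rw [hV]; exact Finset.sum_nonneg fun i _ => sq_nonneg _
  have hG0 : 0 ≤ G := by rw [hG]; exact Finset.sum_nonneg fun i _ => sq_nonneg _
  have h2G : 0 ≤ 2 * G := by linarith
  have hgg : ∀ i, |g i| ≤ √G := fun i => by
    rw [hG]
    exact Real.abs_le_sqrt
      (Finset.single_le_sum (f := fun i => g i ^ 2) (fun i _ => sq_nonneg _) (Finset.mem_univ i))
  have hD1 : |D| ≤ N * B * G := by
    rw [hDe]
    refine (abs_sub _ _).trans ?_
    have t1 : |∑ i, h i i| ≤ n * B := by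
      refine (Finset.abs_sum_le_sum_abs _ _).trans ?_
      refine (Finset.sum_le_sum fun i _ => hh i i).trans ?_
      simp
    have t2 : |∑ i, ∑ j, 2 * (g i * g j * h i j)|
        ≤ ∑ i : Fin n, ∑ j : Fin n, 2 * (G * B) := by
      refine (Finset.abs_sum_le_sum_abs _ _).trans (Finset.sum_le_sum fun i _ => ?_)
      refine (Finset.abs_sum_le_sum_abs _ _).trans (Finset.sum_le_sum fun j _ => ?_)
      rw [abs_mul, abs_mul, abs_mul, abs_of_pos (by norm_num : (0:ℝ) < 2)]
      have h1 : |g i| * |g j| ≤ G := by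
        calc |g i| * |g j| ≤ √G * √G :=
              mul_le_mul (hgg i) (hgg j) (abs_nonneg _) (Real.sqrt_nonneg _)
          _ = G := Real.mul_self_sqrt hG0
      have := mul_le_mul h1 (hh i j) (abs_nonneg _) hG0
      linarith
    simp only [Finset.sum_const, Finset.card_univ, Fintype.card_fin, nsmul_eq_mul] at t2
    rw [abs_mul, abs_of_nonneg h2G]
    have := mul_le_mul_of_nonneg_left t1 h2G
    rw [hN]
    linarith
  have hGB : G ≤ N ^ 2 / K * B ^ 2 := by
    rcases hG0.eq_or_lt with h0 | hpos
    · rw [← h0]; positivity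
    · have h1 : D ^ 2 ≤ (N * B * G) ^ 2 := by
        rw [← sq_abs D]
        exact pow_le_pow_left₀ (abs_nonneg _) hD1 2
      have h2 : K * G * G ^ 2 ≤ N ^ 2 * B ^ 2 * G ^ 2 := by linarith
      have h3 := le_of_mul_le_mul_right h2 (by positivity)
      rw [div_mul_eq_mul_div, le_div_iff₀ hK]
      linarith
  have hCS : (∑ i, v i * g i) ^ 2 ≤ V * G := by
    rw [hV, hG]; exact Finset.sum_mul_sq_le_sq_mul_sq _ _ _
  have hfin : (∑ i, v i * g i) ^ 2 ≤ V * (N ^ 2 / K) * B ^ 2 := by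
    have := mul_le_mul_of_nonneg_left hGB hV0
    linarith
  have := Real.abs_le_sqrt hfin
  rwa [Real.sqrt_mul (by positivity), Real.sqrt_sq hB] at this

lemma grad_bound {n : ℕ} (f p : MvPolynomial (Fin n) ℝ) (K : ℝ) (hK : 0 < K)
    (heq : C K * (gradSq f) ^ 3 - (delta1 f) ^ 2 = p * f) (v : Fin n → ℝ) :
    ∃ A : ℝ, 0 ≤ A ∧ ∀ (x : Fin n → ℝ) (B : ℝ), 0 ≤ B → eval x f = 0 →
      (∀ i j, |eval x (pderiv i (pderiv j f))| ≤ B) →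
      |∑ i, v i * eval x (pderiv i f)| ≤ A * B := by
  refine ⟨√((∑ i, v i ^ 2) * ((2 * ((n : ℝ) + n ^ 2)) ^ 2 / K)), Real.sqrt_nonneg _,
    fun x B hB hx hh => ?_⟩
  have hGe : eval x (gradSq f) = ∑ i, eval x (pderiv i f) ^ 2 := by simp [gradSq]
  refine real_grad (fun i => eval x (pderiv i f)) v (fun i j => eval x (pderiv i (pderiv j f)))
    K _ (eval x (delta1 f)) B _ _ hK hB rfl rfl hGe ?_ ?_ hh
  · have := congrArg (eval x) heq
    simp only [map_sub, map_mul, map_pow, eval_C, hx, mul_zero] at this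
    linarith
  · rw [delta1]
    simp only [map_sub, map_mul, map_sum, lap, map_ofNat]
    congr 1
    refine Finset.sum_congr rfl fun i _ => ?_
    simp only [gradSq, map_sum, Derivation.leibniz_pow, Finset.mul_sum]
    refine Finset.sum_congr rfl fun j _ => ?_
    simp
    ring

/-- restriction of a cubic to a plane, with the derivative along `v` and the Hessian -/
lemma cubic_rep {n : ℕ} (f : MvPolynomial (Fin n) ℝ) (hdeg : f.totalDegree = 3)
    (u v : Fin n → ℝ) : ∃ c0 c1 c2 c3 q0 q1 q2 l0 l1 k : ℝ,
      (∀ s t : ℝ, eval (s • u + t • v) (homogeneousComponent 3 f)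
        = c0 * s ^ 3 + c1 * s ^ 2 * t + c2 * s * t ^ 2 + c3 * t ^ 3) ∧
      (∀ s t : ℝ, eval (s • u + t • v) f
        = c0 * s ^ 3 + c1 * s ^ 2 * t + c2 * s * t ^ 2 + c3 * t ^ 3
          + (q0 * s ^ 2 + q1 * s * t + q2 * t ^ 2) + (l0 * s + l1 * t) + k) ∧
      (∀ s t : ℝ, ∑ i, v i * eval (s • u + t • v) (pderiv i f)
        = c1 * s ^ 2 + 2 * c2 * s * t + 3 * c3 * t ^ 2 + q1 * s + 2 * q2 * t + l1) := by
  obtain ⟨c0, c1, c2, c3, hc⟩ := rep3 _ (homogeneousComponent_isHomogeneous 3 f) u v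
  obtain ⟨q0, q1, q2, hq⟩ := rep2 _ (homogeneousComponent_isHomogeneous 2 f) u v
  obtain ⟨l0, l1, hl⟩ := rep1 _ (homogeneousComponent_isHomogeneous 1 f) u v
  have hf : ∀ s t : ℝ, eval (s • u + t • v) f
        = c0 * s ^ 3 + c1 * s ^ 2 * t + c2 * s * t ^ 2 + c3 * t ^ 3
          + (q0 * s ^ 2 + q1 * s * t + q2 * t ^ 2) + (l0 * s + l1 * t)
          + eval 0 (homogeneousComponent 0 f) := by
    intro s t
    have h0 := hom0 _ (homogeneousComponent_isHomogeneous 0 f) (s • u + t • v) 0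
    conv_lhs => rw [decomp f hdeg]
    simp only [map_add, hc, hq, hl, h0]
    ring
  refine ⟨c0, c1, c2, c3, q0, q1, q2, l0, l1, _, hc, hf, fun s t => ?_⟩
  have h1 := hasDeriv_line f (s • u) v t
  have h2 : HasDerivAt (fun t : ℝ => eval (s • u + t • v) f)
      (c1 * s ^ 2 + 2 * c2 * s * t + 3 * c3 * t ^ 2 + q1 * s + 2 * q2 * t + l1) t := by
    simp only [hf]
    have d1 := hasDerivAt_id' t
    have d2 := hasDerivAt_pow 2 t
    have d3 := hasDerivAt_pow 3 t
    have := ((((((d1.const_mul (c1 * s ^ 2)).const_add (c0 * s ^ 3)).add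
      (d2.const_mul (c2 * s))).add (d3.const_mul c3)).add
      (((d1.const_mul (q1 * s)).const_add (q0 * s ^ 2)).add (d2.const_mul q2))).add
      ((d1.const_mul l1).const_add (l0 * s))).add_const (eval 0 (homogeneousComponent 0 f))
    refine this.congr_deriv ?_
    push_cast
    ring
  exact h1.unique h2

lemma hess_rep {n : ℕ} (f : MvPolynomial (Fin n) ℝ) (hdeg : f.totalDegree = 3)
    (u v : Fin n → ℝ) : ∃ a b c : Fin n → Fin n → ℝ, (∀ i j, ∀ s t : ℝ,
      eval (s • u + t • v) (pderiv i (pderiv j f)) = a i j * s + b i j * t + c i j) ∧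
      ∀ i j, a i j = eval u (pderiv i (pderiv j (homogeneousComponent 3 f))) := by
  have h3 : ∀ i j, (pderiv i (pderiv j (homogeneousComponent 3 f))).IsHomogeneous 1 :=
    fun i j => (homogeneousComponent_isHomogeneous 3 f).pderiv.pderiv
  choose a b hab using fun i j => rep1 _ (h3 i j) u v
  refine ⟨a, b, fun i j => eval 0 (pderiv i (pderiv j (homogeneousComponent 2 f)))
    + eval 0 (pderiv i (pderiv j (homogeneousComponent 1 f)))
    + eval 0 (pderiv i (pderiv j (homogeneousComponent 0 f))), fun i j s t => ?_, fun i j => ?_⟩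
  · have e2 := hom0 (pderiv i (pderiv j (homogeneousComponent 2 f)))
      (homogeneousComponent_isHomogeneous 2 f).pderiv.pderiv (s • u + t • v) 0
    have e1 := hom0 (pderiv i (pderiv j (homogeneousComponent 1 f)))
      (homogeneousComponent_isHomogeneous 1 f).pderiv.pderiv (s • u + t • v) 0
    have e0 := hom0 (pderiv i (pderiv j (homogeneousComponent 0 f)))
      (homogeneousComponent_isHomogeneous 0 f).pderiv.pderiv (s • u + t • v) 0
    conv_lhs => rw [decomp f hdeg]
    simp only [map_add, hab, e2, e1, e0]
    ring
  · have := hab i j 1 0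
    simpa using this.symm

lemma bound_sum {n : ℕ} (a : Fin n → Fin n → ℝ) (i j : Fin n) :
    |a i j| ≤ ∑ i, ∑ j, |a i j| :=
  (Finset.single_le_sum (f := fun j => |a i j|) (fun _ _ => abs_nonneg _)
    (Finset.mem_univ j)).trans
  (Finset.single_le_sum (f := fun i => ∑ j, |a i j|)
    (fun _ _ => Finset.sum_nonneg fun _ _ => abs_nonneg _) (Finset.mem_univ i))

/-- real zeros of the leading form are critical -/
lemma stage1_crit {n : ℕ} (f p : MvPolynomial (Fin n) ℝ) (hdeg : f.totalDegree = 3)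
    (K : ℝ) (hK : 0 < K) (heq : C K * (gradSq f) ^ 3 - (delta1 f) ^ 2 = p * f)
    (v : Fin n → ℝ) (hv : eval v (homogeneousComponent 3 f) = 1)
    (u : Fin n → ℝ) (hu : eval u (homogeneousComponent 3 f) = 0) :
    ∃ c : ℝ, ∀ t : ℝ, eval (u + t • v) (homogeneousComponent 3 f) = c * t ^ 2 + t ^ 3 := by
  obtain ⟨c0, c1, c2, c3, q0, q1, q2, l0, l1, k, hc, hf, hd⟩ := cubic_rep f hdeg u v
  obtain ⟨a, b, c, hess, -⟩ := hess_rep f hdeg u v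
  obtain ⟨A, hA0, hA⟩ := grad_bound f p K hK heq v
  have hc0 : c0 = 0 := by
    have := hc 1 0
    simp [hu] at this
    exact this.symm
  have hc3 : c3 = 1 := by
    have := hc 0 1
    simp [hv] at this
    exact this.symm
  subst hc0 hc3
  obtain ⟨N, hN⟩ : ∃ N : ℝ, N = (∑ i, ∑ j, |a i j|) + (∑ i, ∑ j, |b i j|) + ∑ i, ∑ j, |c i j| :=
    ⟨_, rfl⟩
  have nn : ∀ a : Fin n → Fin n → ℝ, 0 ≤ ∑ i, ∑ j, |a i j| := fun a =>
    Finset.sum_nonneg fun i _ => Finset.sum_nonneg fun j _ => abs_nonneg _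
  have na := nn a
  have nb := nn b
  have nc := nn c
  have hN0 : 0 ≤ N := by linarith
  have hc1 : c1 = 0 := by
    refine real_stage1 (A * N) c1 c2 q0 q1 q2 l0 l1 k (mul_nonneg hA0 hN0) fun s t hst => ?_
    have hz : eval (s • u + t • v) f = 0 := by rw [hf]; linear_combination hst
    have hs := abs_nonneg s
    have ht := abs_nonneg t
    have := hA (s • u + t • v) (N * (1 + |s| + |t|)) (by positivity) hz ?_
    · rw [hd] at this
      rw [mul_assoc A N]
      convert this using 2
      ring
    · intro i j
      rw [hess]
      have b1 := bound_sum a i j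
      have b2 := bound_sum b i j
      have b3 := bound_sum c i j
      have h1 : |a i j| ≤ N := by linarith
      have h2 : |b i j| ≤ N := by linarith
      have h3 : |c i j| ≤ N := by linarith
      have m1 := mul_le_mul_of_nonneg_right h1 hs
      have m2 := mul_le_mul_of_nonneg_right h2 ht
      refine (abs_add_le _ _).trans ?_
      have := abs_add_le (a i j * s) (b i j * t)
      rw [abs_mul, abs_mul] at this
      linarith
  subst hc1
  refine ⟨c2, fun t => ?_⟩
  have := hc 1 t
  rw [one_smul] at this
  rw [this]; ring

lemma stage1 {n : ℕ} (f p : MvPolynomial (Fin n) ℝ) (hdeg : f.totalDegree = 3)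
    (K : ℝ) (hK : 0 < K) (heq : C K * (gradSq f) ^ 3 - (delta1 f) ^ 2 = p * f)
    (v : Fin n → ℝ) (hv : eval v (homogeneousComponent 3 f) = 1) (w : Fin n → ℝ) :
    ∃ τ : ℝ, ∀ t : ℝ, eval (w + t • v) (homogeneousComponent 3 f) = (t + τ) ^ 3 := by
  have crit := stage1_crit f p hdeg K hK heq v hv
  obtain ⟨c0, c1, c2, c3, hc⟩ := rep3 _ (homogeneousComponent_isHomogeneous 3 f) w v
  have hc3 : c3 = 1 := by
    have := hc 0 1
    simp [hv] at this
    exact this.symm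
  subst hc3
  obtain ⟨t0, ht0⟩ := cubic_root 1 c2 c1 c0 one_ne_zero
  have hu : eval (w + t0 • v) (homogeneousComponent 3 f) = 0 := by
    have := hc 1 t0
    rw [one_smul] at this
    rw [this]; linear_combination ht0
  obtain ⟨c, hcc⟩ := crit _ hu
  have hu2 : eval (w + t0 • v + (-c) • v) (homogeneousComponent 3 f) = 0 := by
    rw [hcc]; ring
  obtain ⟨cprm, hccprm⟩ := crit _ hu2
  have key : ∀ t : ℝ, c * (t - c) ^ 2 + (t - c) ^ 3 = cprm * t ^ 2 + t ^ 3 := by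
    intro t
    rw [← hcc, ← hccprm]
    congr 2
    module
  have hc0 : c = 0 := by
    have k1 := key 1
    have k2 := key (-1)
    have : c ^ 2 = 0 := by linarith
    exact pow_eq_zero_iff (two_ne_zero) |>.mp this
  subst hc0
  refine ⟨-t0, fun t => ?_⟩
  have := hcc (t - t0)
  rw [show w + t0 • v + (t - t0) • v = w + t • v by module] at this
  rw [this]; ring

lemma second_deriv {n : ℕ} (p : MvPolynomial (Fin n) ℝ) (v w : Fin n → ℝ) (τ : ℝ)
    (h : ∀ t : ℝ, eval (w + t • v) p = (t + τ) ^ 3) :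
    eval w (C (1 / 6) * ∑ i, C (v i) * pderiv i (∑ j, C (v j) * pderiv j p)) = τ := by
  have e : ∀ (q : MvPolynomial (Fin n) ℝ) x, eval x (∑ j, C (v j) * pderiv j q)
      = ∑ j, v j * eval x (pderiv j q) := by intro q x; simp
  have h1 : ∀ t : ℝ, eval (w + t • v) (∑ j, C (v j) * pderiv j p) = 3 * (t + τ) ^ 2 := by
    intro t
    rw [e]
    have d1 := hasDeriv_line p w v t
    simp only [h] at d1
    have d2 := ((hasDerivAt_id' t).add_const τ).pow 3
    have := d1.unique d2
    rw [this]; norm_num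
  have h2 : eval (w + (0:ℝ) • v) (∑ i, C (v i) * pderiv i (∑ j, C (v j) * pderiv j p))
      = 6 * τ := by
    rw [e]
    have d1 := hasDeriv_line (∑ j, C (v j) * pderiv j p) w v 0
    simp only [h1] at d1
    have d2 := (((hasDerivAt_id' (0:ℝ)).add_const τ).pow 2).const_mul 3
    have := d1.unique d2
    rw [this]; norm_num; ring
  rw [zero_smul, add_zero] at h2
  rw [map_mul, h2, eval_C]; ring

lemma main_pos {n : ℕ} (f p : MvPolynomial (Fin n) ℝ) (hirr : Irreducible f)
    (hdeg : f.totalDegree = 3)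
    (K : ℝ) (hK : 0 < K) (heq : C K * (gradSq f) ^ 3 - (delta1 f) ^ 2 = p * f) : False := by
  obtain ⟨v, hv⟩ : ∃ v : Fin n → ℝ, eval v (homogeneousComponent 3 f) = 1 := by
    obtain ⟨vprm, hvprm⟩ := exists_dir f hdeg
    obtain ⟨r, hr⟩ := cubic_root 1 0 0 (-1 / eval vprm (homogeneousComponent 3 f)) one_ne_zero
    refine ⟨r • vprm, ?_⟩
    obtain ⟨c0, c1, c2, c3, hc⟩ := rep3 _ (homogeneousComponent_isHomogeneous 3 f) 0 vprm
    have h1 := hc 0 1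
    have h2 := hc 0 r
    simp at h1 h2
    rw [h2, ← h1]
    have : r ^ 3 = 1 / eval vprm (homogeneousComponent 3 f) := by linear_combination hr
    rw [this]
    field_simp
  have st1 := stage1 f p hdeg K hK heq v hv
  obtain ⟨a, ha⟩ : ∃ a : MvPolynomial (Fin n) ℝ, ∀ w (t : ℝ),
      eval (w + t • v) (homogeneousComponent 3 f) = (t + eval w a) ^ 3 := by
    refine ⟨C (1 / 6) * ∑ i, C (v i) * pderiv i (∑ j, C (v j) *
      pderiv j (homogeneousComponent 3 f)), fun w t => ?_⟩
    obtain ⟨τ, hτ⟩ := st1 w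
    rw [second_deriv _ v w τ hτ, hτ]
  have ha0 : ∀ w, eval w (homogeneousComponent 3 f) = eval w a ^ 3 := by
    intro w
    simpa using ha w 0
  have hshift : ∀ w (t : ℝ), eval (w + t • v) a = t + eval w a := by
    intro w t
    have := ha w t
    rw [ha0] at this
    exact (Odd.strictMono_pow (by decide : Odd 3)).injective this
  have hf3 : homogeneousComponent 3 f = a ^ 3 :=
    MvPolynomial.funext fun w => by rw [ha0, map_pow]
  have hz : ∀ w (s : ℝ), eval w a = 0 → eval (s • w) a = 0 := by
    intro w s hw
    obtain ⟨c0, c1, c2, c3, hc⟩ := rep3 _ (homogeneousComponent_isHomogeneous 3 f) w v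
    have h1 := hc 1 0
    have h2 := hc s 0
    simp [ha0, hw] at h1 h2
    rw [← h1, zero_mul] at h2
    exact pow_eq_zero_iff (three_ne_zero) |>.mp h2
  have h00 : eval 0 a = 0 := by
    obtain ⟨c0, c1, c2, c3, hc⟩ := rep3 _ (homogeneousComponent_isHomogeneous 3 f) v v
    have h1 := hc 0 0
    simp only [zero_smul, add_zero, ha0] at h1
    have h2 : eval 0 a ^ 3 = 0 := by rw [h1]; ring
    exact pow_eq_zero_iff (three_ne_zero) |>.mp h2
  have hav : ∀ t : ℝ, eval (t • v) a = t := by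
    intro t
    have := hshift 0 t
    rwa [zero_add, h00, add_zero] at this
  obtain ⟨A, hA0, hA⟩ := grad_bound f p K hK heq v
  have st2 : ∀ w, eval w a = 0 → ∀ t : ℝ, eval (w + t • v) f = eval (t • v) f := by
    intro w hw
    obtain ⟨c0, c1, c2, c3, q0, q1, q2, l0, l1, k, hc, hf, hd⟩ := cubic_rep f hdeg w v
    obtain ⟨α, b, c, hess, hα⟩ := hess_rep f hdeg w v
    have hα0 : ∀ i j, α i j = 0 := by
      intro i j
      rw [hα, hf3]
      simp [Derivation.leibniz_pow, Derivation.leibniz, hw]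
    have hcs : ∀ s t : ℝ, c0 * s ^ 3 + c1 * s ^ 2 * t + c2 * s * t ^ 2 + c3 * t ^ 3 = t ^ 3 := by
      intro s t
      rw [← hc, ha, hz w s hw, add_zero]
    have e1 := hcs 1 0
    have e2 := hcs 0 1
    have e3 := hcs 1 1
    have e4 := hcs 1 (-1)
    have hc0 : c0 = 0 := by linarith
    have hc3 : c3 = 1 := by linarith
    have hc1 : c1 = 0 := by linarith
    have hc2 : c2 = 0 := by linarith
    subst hc0 hc1 hc2 hc3
    obtain ⟨N, hN⟩ : ∃ N : ℝ, N = (∑ i, ∑ j, |b i j|) + ∑ i, ∑ j, |c i j| := ⟨_, rfl⟩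
    have nn : ∀ a : Fin n → Fin n → ℝ, 0 ≤ ∑ i, ∑ j, |a i j| := fun a =>
      Finset.sum_nonneg fun i _ => Finset.sum_nonneg fun j _ => abs_nonneg _
    have nb := nn b
    have nc := nn c
    have hN0 : 0 ≤ N := by linarith
    obtain ⟨h1, h2, h3⟩ : q1 = 0 ∧ q0 = 0 ∧ l0 = 0 := by
      refine real_stage2 (A * N) q0 q1 q2 l0 l1 k (mul_nonneg hA0 hN0) fun s t hst => ?_
      have hz : eval (s • w + t • v) f = 0 := by rw [hf]; linear_combination hst
      have ht := abs_nonneg t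
      have := hA (s • w + t • v) (N * (1 + |t|)) (by positivity) hz ?_
      · rw [hd] at this
        rw [mul_assoc A N]
        convert this using 2
        ring
      · intro i j
        rw [hess, hα0]
        have b2 := bound_sum b i j
        have b3 := bound_sum c i j
        have h2 : |b i j| ≤ N := by linarith
        have h3 : |c i j| ≤ N := by linarith
        have m2 := mul_le_mul_of_nonneg_right h2 ht
        have := abs_add_le (b i j * t) (c i j)
        rw [abs_mul] at this
        rw [zero_mul, zero_add]
        linarith
    subst h1 h2 h3
    intro t
    have g1 := hf 1 t
    have g2 := hf 0 t
    simp only [one_smul, zero_smul, zero_add] at g1 g2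
    rw [g1, g2]; ring
  obtain ⟨c0, c1, c2, c3, q0, q1, q2, l0, l1, k, hc, hf, hd⟩ := cubic_rep f hdeg 0 v
  have hc3 : c3 = 1 := by
    have := hc 0 1
    simp [hv] at this
    exact this.symm
  refine final_red f a hirr v c3 q2 l1 k (by rw [hc3]; exact one_ne_zero) hav fun x => ?_
  have hx := st2 (x + (-eval x a) • v) (by rw [hshift]; ring) (eval x a)
  rw [show x + (-eval x a) • v + eval x a • v = x by module] at hx
  have hfx := hf 0 (eval x a)
  simp only [zero_smul, zero_add] at hfx
  rw [hx, hfx]; ring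

lemma case_one (f : MvPolynomial (Fin 1) ℝ) (hirr : Irreducible f)
    (hdeg : f.totalDegree = 3) : False := by
  obtain ⟨vprm, hvprm⟩ := exists_dir f hdeg
  have hx : ∀ x : Fin 1 → ℝ, x = x 0 • (fun _ => (1:ℝ)) := by
    intro x; funext i; fin_cases i; simp
  obtain ⟨c0, c1, c2, c3, q0, q1, q2, l0, l1, k, hc, hf, hd⟩ :=
    cubic_rep f hdeg 0 (fun _ => (1:ℝ))
  refine final_red f (X 0) hirr (fun _ => (1:ℝ)) c3 q2 l1 k ?_ (by intro t; simp) fun x => ?_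
  · rintro rfl
    apply hvprm
    rw [hx vprm]
    have := hc 0 (vprm 0)
    simp only [zero_smul, zero_add] at this
    rw [this]; ring
  · have := hf 0 (x 0)
    simp only [zero_smul, zero_add] at this
    rw [← hx x] at this
    rw [this, eval_X]; ring

/-- Main theorem: there is no irreducible cubic polynomial on ℝⁿ satisfying the
cmc equation 4(n−1)²H²|∇f|⁶ − (Δ₁f)² = p·f with H ≠ 0. -/
theorem stmt_14 (n : ℕ) (f : MvPolynomial (Fin n) ℝ)
    (hirr : Irreducible f) (hdeg : f.totalDegree = 3) :
    ¬ ∃ (H : ℝ) (p : MvPolynomial (Fin n) ℝ), H ≠ 0 ∧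
      C (4 * ((n : ℝ) - 1) ^ 2 * H ^ 2) * (gradSq f) ^ 3 - (delta1 f) ^ 2 = p * f := by
  rintro ⟨H, p, hH, heq⟩
  by_cases hn : n = 1
  · subst hn
    exact case_one f hirr hdeg
  · have h1 : (n : ℝ) - 1 ≠ 0 := by
      rw [sub_ne_zero]; exact_mod_cast hn
    exact main_pos f p hirr hdeg _ (by positivity) heq
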